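/- For n ≥ 1 and k ≥ 0, the number of packed words of length n with supremum k that contain at least one occurrence of the letter x₀ equals S(n,k+1)·(k+1)!, where S(n,k) is the Stirling number of the second kind. -/

import Mathlib

/-- Words over the alphabet `X = {x_i : i ≥ 0}`, identified with lists of natural numbers. -/
abbrev Word : Type := List ℕ

/-- `IAlph w` is the set of indices of letters occurring in `w`. -/
def IAlph (w : Word) : Finset ℕ := w.toFinset

/-- `wsup w` is the supremum of `IAlph w` (0 for the empty word). -/
def wsup (w : Word) : ℕ := w.foldr max 0

/-- The substitution `S_φ` replaces each letter `x_i` by `x_{φ i}`. -/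
def subst (φ : ℕ → ℕ) (w : Word) : Word := w.map φ

/-- The packing substitution `φ_w`: it sends the `m`-th smallest nonzero letter of `w` to `m`,
and `0` to `0`. -/
def packMap (w : Word) (i : ℕ) : ℕ := (((IAlph w).erase 0).filter (fun j => j ≤ i)).card

/-- `pack w = S_{φ_w} w`. -/
def pack (w : Word) : Word := subst (packMap w) w

/-- A word is packed if `pack w = w`. -/
def IsPacked (w : Word) : Prop := pack w = w

/-- `T_t`: shift every nonzero letter by `t`, fixing `x_0`. -/
def shiftW (t : ℕ) (w : Word) : Word := subst (fun n => if n = 0 then 0 else n + t) w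

/-- Shifted concatenation `u * v = u · T_{sup u}(v)`. -/
def sc (u v : Word) : Word := u ++ shiftW (wsup u) v

/-- `w[I]`: the subword of `w` formed by the letters at the (1-indexed) positions in `I`,
taken in increasing order of position. -/
def subword (w : Word) (I : Finset ℕ) : Word :=
  ((List.range w.length).filter (fun j => decide (j + 1 ∈ I))).map (fun j => w.getD j 0)

/-- Quotient by a set of indices: `w / A = S_{φ_A} w` where `φ_A i = 0` if `i ∈ A`, else `i`. -/
def quotSet (w : Word) (A : Finset ℕ) : Word := subst (fun i => if i ∈ A then 0 else i) w

/-- Quotient by a word: `w / u = w / IAlph u`. -/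
def quotWord (w u : Word) : Word := quotSet w (IAlph u)

/-- Stirling numbers of the second kind: `stirling2 n k` is the number of set partitions of
an `n`-element set into exactly `k` nonempty blocks.  They satisfy `S(0,0) = 1`,
`S(n,0) = 0` for `n > 0`, `S(0,k) = 0` for `k > 0`, and
`S(n+1,k+1) = S(n,k) + (k+1)·S(n,k+1)`. -/
def stirling2 : ℕ → ℕ → ℕ
  | 0, 0 => 1
  | 0, _ + 1 => 0
  | _ + 1, 0 => 0
  | n + 1, k + 1 => stirling2 n k + (k + 1) * stirling2 n (k + 1)

/-- The lists of length `n` whose set of entries is exactly `S`. -/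
def listsWithEntries {α : Type*} [DecidableEq α] : ℕ → Finset α → Finset (List α)
  | 0, S => if S = ∅ then {[]} else ∅
  | n + 1, S => S.biUnion fun a =>
      (listsWithEntries n S ∪ listsWithEntries n (S.erase a)).image (List.cons a)

theorem mem_listsWithEntries {α : Type*} [DecidableEq α] (n : ℕ) (S : Finset α) (l : List α) :
    l ∈ listsWithEntries n S ↔ l.length = n ∧ l.toFinset = S := by
  induction n generalizing S l with
  | zero =>
    simp only [listsWithEntries, List.length_eq_zero_iff]
    split_ifs with h
    · subst h
      simp +contextual
    · simp only [Finset.notMem_empty, false_iff, not_and]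
      rintro rfl h'
      exact h (by simpa using h'.symm)
  | succ n ih =>
    simp only [listsWithEntries, Finset.mem_biUnion, Finset.mem_image, Finset.mem_union, ih]
    constructor
    · rintro ⟨a, ha, t, ⟨hl, ht⟩ | ⟨hl, ht⟩, rfl⟩
      · simp [hl, ht, ha]
      · simp [hl, ht, Finset.insert_erase ha]
    · rintro ⟨hl, hS⟩
      obtain _ | ⟨a, t⟩ := l
      · simp at hl
      · have hl' : t.length = n := by simpa using hl
        rw [List.toFinset_cons] at hS
        refine ⟨a, hS ▸ Finset.mem_insert_self _ _, t, ?_, rfl⟩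
        by_cases hat : a ∈ t.toFinset
        · exact Or.inl ⟨hl', by rw [← hS, Finset.insert_eq_of_mem hat]⟩
        · exact Or.inr ⟨hl', by rw [← hS, Finset.erase_insert hat]⟩

theorem card_listsWithEntries {α : Type*} [DecidableEq α] (n : ℕ) (S : Finset α) :
    (listsWithEntries n S).card = stirling2 n S.card * S.card.factorial := by
  induction n generalizing S with
  | zero =>
    rcases S.eq_empty_or_nonempty with rfl | h
    · simp [listsWithEntries, stirling2]
    · obtain ⟨m, hm⟩ := Nat.exists_eq_succ_of_ne_zero h.card_pos.ne'
      simp [listsWithEntries, stirling2, h.ne_empty, hm]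
  | succ n ih =>
    rw [listsWithEntries, Finset.card_biUnion]
    · rcases hm : S.card with _ | m
      · simp [Finset.card_eq_zero.mp hm, stirling2]
      · have key : ∀ a ∈ S, ((listsWithEntries n S ∪ listsWithEntries n (S.erase a)).image
            (List.cons a)).card
              = stirling2 n (m + 1) * (m + 1).factorial + stirling2 n m * m.factorial := by
          intro a ha
          rw [Finset.card_image_of_injective _ List.cons_injective, Finset.card_union_of_disjoint,
            ih, ih, Finset.card_erase_of_mem ha, hm, Nat.add_sub_cancel]
          refine Finset.disjoint_left.mpr fun l h₁ h₂ => ?_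
          rw [mem_listsWithEntries] at h₁ h₂
          exact Finset.notMem_erase a S (h₂.2 ▸ h₁.2.symm ▸ ha)
        rw [Finset.sum_congr rfl key, Finset.sum_const, hm, stirling2, Nat.factorial_succ,
          smul_eq_mul]
        ring
    · intro a _ b _ hab
      refine Finset.disjoint_left.mpr fun l h₁ h₂ => ?_
      obtain ⟨t, -, rfl⟩ := Finset.mem_image.mp h₁
      obtain ⟨u, -, hu⟩ := Finset.mem_image.mp h₂
      exact hab (List.cons.inj hu).1.symm

theorem le_wsup {w : Word} {i : ℕ} (hi : i ∈ w) : i ≤ wsup w := by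
  induction w with
  | nil => simp at hi
  | cons a t ih =>
    rcases List.mem_cons.mp hi with rfl | h
    · exact le_max_left _ _
    · exact (ih h).trans (le_max_right _ _)

theorem wsup_le {w : Word} {k : ℕ} (h : ∀ i ∈ w, i ≤ k) : wsup w ≤ k := by
  induction w with
  | nil => exact Nat.zero_le _
  | cons a t ih =>
    exact max_le (h a List.mem_cons_self) (ih fun i hi => h i (List.mem_cons_of_mem _ hi))

theorem wsup_mem {w : Word} (hw : 0 ∈ w) : wsup w ∈ w := by
  obtain ⟨m, hm, hmax⟩ := w.toFinset.exists_max_image id ⟨0, List.mem_toFinset.mpr hw⟩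
  rw [List.mem_toFinset] at hm
  have : wsup w = m :=
    le_antisymm (wsup_le fun i hi => hmax i (List.mem_toFinset.mpr hi)) (le_wsup hm)
  rwa [this]

theorem isPacked_iff (w : Word) : IsPacked w ↔ ∀ i ∈ w, packMap w i = i := by
  simpa [IsPacked, pack, subst] using
    (List.map_inj_left (f := packMap w) (g := id) (l := w))

theorem isPacked_wsup_zero_mem_iff (w : Word) (k : ℕ) :
    (IsPacked w ∧ wsup w = k ∧ 0 ∈ w) ↔ w.toFinset = Finset.range (k + 1) := by
  rw [isPacked_iff]
  constructor
  · rintro ⟨hp, rfl, h0⟩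
    have hcard := hp _ (wsup_mem h0)
    have hsub : ((IAlph w).erase 0).filter (fun j => j ≤ wsup w) ⊆ Finset.Icc 1 (wsup w) := by
      intro j hj
      simp only [Finset.mem_filter, Finset.mem_erase] at hj
      exact Finset.mem_Icc.mpr ⟨Nat.pos_of_ne_zero hj.1.1, hj.2⟩
    have heq := Finset.eq_of_subset_of_card_le hsub (by simpa [packMap] using hcard.ge)
    ext i
    rw [List.mem_toFinset, Finset.mem_range, Nat.lt_succ_iff]
    refine ⟨le_wsup, fun hi => ?_⟩
    rcases Nat.eq_zero_or_pos i with rfl | hpos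
    · exact h0
    · have := heq ▸ Finset.mem_Icc.mpr ⟨hpos, hi⟩
      simp only [Finset.mem_filter, Finset.mem_erase, IAlph, List.mem_toFinset] at this
      exact this.1.2
  · intro h
    have hmem : ∀ i, i ∈ w ↔ i ≤ k := fun i => by
      rw [← List.mem_toFinset, h, Finset.mem_range, Nat.lt_succ_iff]
    refine ⟨fun i hi => ?_, le_antisymm (wsup_le fun i => (hmem i).mp)
      (le_wsup ((hmem k).mpr le_rfl)), (hmem 0).mpr (Nat.zero_le _)⟩
    have hik := (hmem i).mp hi
    have : ((IAlph w).erase 0).filter (fun j => j ≤ i) = Finset.Icc 1 i := by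
      ext j
      simp only [IAlph, h, Finset.mem_filter, Finset.mem_erase, Finset.mem_range, Finset.mem_Icc]
      omega
    simp [packMap, this]

/-- For `n ≥ 1`, `k ≥ 0`, the number of packed words of length `n` with
supremum `k` containing at least one occurrence of the letter `x₀` is `S(n,k+1)·(k+1)!`. -/
theorem card_packed_with_zero (n k : ℕ) (hn : 1 ≤ n) :
    Nat.card {w : Word // IsPacked w ∧ w.length = n ∧ wsup w = k ∧ (0 : ℕ) ∈ w}
      = stirling2 n (k + 1) * Nat.factorial (k + 1) := by
  have hcard := card_listsWithEntries n (Finset.range (k + 1))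
  rw [Finset.card_range] at hcard
  rw [← hcard]
  refine Nat.subtype_card _ fun w => ?_
  rw [mem_listsWithEntries, ← isPacked_wsup_zero_mem_iff]
  tauto
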